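/- arXiv:2011.03916 — 8 statements merged into one kernel-verified Lean document; each statement's English description precedes it below -/
import Mathlib

section
/- Let d ∈ (0,1). The function g^M_d is monotonically increasing on [0,1]: for all ω₁, ω₂ ∈ [0,1] with ω₁ ≤ ω₂ one has g^M_d(ω₁) ≤ g^M_d(ω₂). -/
/-- The WENO-M mapping function `g^M_d`. -/
noncomputable def gM (d ω : ℝ) : ℝ :=
  ω * (d + d ^ 2 - 3 * d * ω + ω ^ 2) / (d ^ 2 + (1 - 2 * d) * ω)

theorem gM_denom_pos {d ω : ℝ} (hd : d ∈ Set.Ioo (0 : ℝ) 1) (hω : ω ∈ Set.Icc (0 : ℝ) 1) :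
    0 < d ^ 2 + (1 - 2 * d) * ω := by
  obtain ⟨hd0, hd1⟩ := hd
  obtain ⟨h0, h1⟩ := hω
  rcases h0.eq_or_lt with rfl | h0
  · simpa using pow_pos hd0 2
  · have h : 0 < ω * (1 - d) ^ 2 := mul_pos h0 (pow_pos (sub_pos.2 hd1) 2)
    have h' : 0 ≤ (1 - ω) * d ^ 2 := mul_nonneg (sub_nonneg.2 h1) (sq_nonneg d)
    linarith

theorem gM_eq_add_cube_div {d ω : ℝ} (h : d ^ 2 + (1 - 2 * d) * ω ≠ 0) :
    gM d ω = d + (ω - d) ^ 3 / (d ^ 2 + (1 - 2 * d) * ω) := by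
  rw [gM, div_eq_iff h, add_mul, div_mul_cancel₀ _ h]
  ring

theorem stmt_1 (d : ℝ) (hd : d ∈ Set.Ioo (0 : ℝ) 1) :
    ∀ ω₁ ∈ Set.Icc (0 : ℝ) 1, ∀ ω₂ ∈ Set.Icc (0 : ℝ) 1,
      ω₁ ≤ ω₂ → gM d ω₁ ≤ gM d ω₂ := by
  intro a ha b hb hab
  have hA := gM_denom_pos hd ha
  have hB := gM_denom_pos hd hb
  rw [gM_eq_add_cube_div hA.ne', gM_eq_add_cube_div hB.ne', add_le_add_iff_left,
    div_le_div_iff₀ hA hB]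
  have hp : 0 < d * (1 - d) := mul_pos hd.1 (sub_pos.2 hd.2)
  rcases le_total 0 ((a - d) * (b - d)) with h | h
  · have h₁ := mul_nonneg h (add_pos hA hB).le
    have h₂ : 0 ≤ d * (1 - d) * ((a - d) ^ 2 - (a - d) * (b - d) + (b - d) ^ 2) :=
      mul_nonneg hp.le (by nlinarith [sq_nonneg (a - b)])
    have h₃ := mul_nonneg (sub_nonneg.2 hab) (add_nonneg h₁ h₂)
    linarith
  · have hx : a - d ≤ 0 := by
      by_contra! hx
      nlinarith
    have hy : 0 ≤ b - d := by
      by_contra! hy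
      nlinarith
    exact (mul_nonpos_of_nonpos_of_nonneg (Odd.pow_nonpos (by decide) hx) hB.le).trans
      (mul_nonneg (pow_nonneg hy 3) hA.le)
end

section
/- Let d ∈ (0,1). The function g^M_d, given by the same rational formula on an open neighborhood of d (where the denominator d² + (1 − 2d)ω is positive), satisfies (g^M_d)'(d) = 0 and (g^M_d)''(d) = 0, while the third derivative (g^M_d)'''(d) is nonzero (indeed (g^M_d)'''(d) = 6/(d(1 − d))). -/
theorem hasDerivAt_sub_pow_div_pow (a b c x : ℝ) (m n : ℕ) (h : b + c * x ≠ 0) :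
    HasDerivAt (fun ω : ℝ => (ω - a) ^ (m + 1) / (b + c * ω) ^ n)
      ((m + 1) * ((x - a) ^ m / (b + c * x) ^ n)
        - n * c * ((x - a) ^ (m + 1) / (b + c * x) ^ (n + 1))) x := by
  have hD : HasDerivAt (fun ω : ℝ => b + c * ω) c x := by
    simpa using ((hasDerivAt_id x).const_mul c).const_add b
  have hN : HasDerivAt (fun ω : ℝ => ω - a) 1 x := (hasDerivAt_id x).sub_const a
  refine ((hN.fun_pow (m + 1)).fun_div (hD.fun_pow n) (pow_ne_zero n h)).congr_deriv ?_
  rcases n with _ | n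
  · simp
  · simp only [Nat.add_sub_cancel]
    push_cast
    generalize b + c * x = y at h
    field_simp
    ring

theorem stmt_2 (d : ℝ) (hd : d ∈ Set.Ioo (0 : ℝ) 1) :
    (∀ᶠ ω in nhds d, 0 < d ^ 2 + (1 - 2 * d) * ω) ∧
    deriv (gM d) d = 0 ∧
    iteratedDeriv 2 (gM d) d = 0 ∧
    iteratedDeriv 3 (gM d) d = 6 / (d * (1 - d)) ∧
    iteratedDeriv 3 (gM d) d ≠ 0 := by
  have hd₀ : 0 < d * (1 - d) := mul_pos hd.1 (sub_pos.2 hd.2)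
  have hpos : ∀ᶠ ω in nhds d, 0 < d ^ 2 + (1 - 2 * d) * ω :=
    ContinuousAt.eventually_lt (by fun_prop) (by fun_prop) (by linarith)
  have hquot (x : ℝ) (m n : ℕ) (hx : 0 < d ^ 2 + (1 - 2 * d) * x) :=
    hasDerivAt_sub_pow_div_pow d (d ^ 2) (1 - 2 * d) x m n hx.ne'
  let D : ℝ → ℝ := fun ω => d ^ 2 + (1 - 2 * d) * ω
  have hgM : gM d =ᶠ[nhds d] fun ω => d + (ω - d) ^ 3 / D ω ^ 1 :=
    hpos.mono fun ω hω => by simpa using gM_eq_add_cube_div hω.ne'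
  have h₁ : deriv (gM d) =ᶠ[nhds d] fun ω =>
      3 * ((ω - d) ^ 2 / D ω ^ 1) - (1 - 2 * d) * ((ω - d) ^ 3 / D ω ^ 2) := by
    refine hgM.deriv.trans (hpos.mono fun ω hω => ?_)
    refine ((hquot ω 2 1 hω).const_add d).deriv.trans ?_
    push_cast
    ring
  have h₂ : iteratedDeriv 2 (gM d) =ᶠ[nhds d] fun ω =>
      6 * ((ω - d) ^ 1 / D ω ^ 1) - 6 * (1 - 2 * d) * ((ω - d) ^ 2 / D ω ^ 2)
        + 2 * (1 - 2 * d) ^ 2 * ((ω - d) ^ 3 / D ω ^ 3) := by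
    rw [iteratedDeriv_succ, iteratedDeriv_one]
    refine h₁.deriv.trans (hpos.mono fun ω hω => ?_)
    refine (((hquot ω 1 1 hω).const_mul 3).fun_sub
      ((hquot ω 2 2 hω).const_mul (1 - 2 * d))).deriv.trans ?_
    push_cast
    ring
  have h₃ : iteratedDeriv 3 (gM d) d = 6 / (d * (1 - d)) := by
    have hd' := hpos.self_of_nhds
    rw [iteratedDeriv_succ, h₂.deriv_eq]
    refine ((((hquot d 0 1 hd').const_mul 6).fun_sub
      ((hquot d 1 2 hd').const_mul (6 * (1 - 2 * d)))).fun_add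
        ((hquot d 2 3 hd').const_mul (2 * (1 - 2 * d) ^ 2))).deriv.trans ?_
    have hDd : d ^ 2 + (1 - 2 * d) * d = d * (1 - d) := by ring
    simp [hDd, div_eq_mul_inv]
  refine ⟨hpos, ?_, ?_, h₃, ?_⟩
  · simp [h₁.self_of_nhds]
  · simp [h₂.self_of_nhds]
  · rw [h₃]
    positivity
end

section
/- Let d ∈ (0,1). There exists a constant C > 0 such that for all ω ∈ [0,1], |g^M_d(ω) − d| ≤ C·|ω − d|³. -/
theorem le_gM_denom {d ω : ℝ} (hd : d ∈ Set.Ioo (0 : ℝ) 1) (hω : ω ∈ Set.Icc (0 : ℝ) 1) :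
    d ^ 2 * (1 - d) ^ 2 ≤ d ^ 2 + (1 - 2 * d) * ω := by
  obtain ⟨hd0, hd1⟩ := hd
  obtain ⟨hω0, hω1⟩ := hω
  have h₁ : d ^ 2 * (1 - d) ^ 2 ≤ d ^ 2 :=
    mul_le_of_le_one_right (sq_nonneg d) (pow_le_one₀ (by linarith) (by linarith))
  have h₂ : d ^ 2 * (1 - d) ^ 2 ≤ (1 - d) ^ 2 :=
    mul_le_of_le_one_left (sq_nonneg _) (pow_le_one₀ hd0.le hd1.le)
  calc d ^ 2 * (1 - d) ^ 2
      = (1 - ω) * (d ^ 2 * (1 - d) ^ 2) + ω * (d ^ 2 * (1 - d) ^ 2) := by ring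
    _ ≤ (1 - ω) * d ^ 2 + ω * (1 - d) ^ 2 :=
      add_le_add (mul_le_mul_of_nonneg_left h₁ (by linarith)) (mul_le_mul_of_nonneg_left h₂ hω0)
    _ = d ^ 2 + (1 - 2 * d) * ω := by ring

theorem gM_sub_self {d ω : ℝ} (h : d ^ 2 + (1 - 2 * d) * ω ≠ 0) :
    gM d ω - d = (ω - d) ^ 3 / (d ^ 2 + (1 - 2 * d) * ω) := by
  rw [gM, div_sub' h]
  congr 1
  ring

theorem stmt_3 (d : ℝ) (hd : d ∈ Set.Ioo (0 : ℝ) 1) :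
    ∃ C : ℝ, 0 < C ∧ ∀ ω ∈ Set.Icc (0 : ℝ) 1,
      |gM d ω - d| ≤ C * |ω - d| ^ 3 := by
  have hm : 0 < d ^ 2 * (1 - d) ^ 2 :=
    mul_pos (pow_pos hd.1 2) (pow_pos (sub_pos.2 hd.2) 2)
  refine ⟨(d ^ 2 * (1 - d) ^ 2)⁻¹, inv_pos.2 hm, fun ω hω => ?_⟩
  have hle := le_gM_denom hd hω
  have hpos := hm.trans_le hle
  rw [gM_sub_self hpos.ne', abs_div, abs_pow, abs_of_pos hpos, div_eq_inv_mul]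
  gcongr
end

section
/- Let d ∈ (0,1), let k be a positive even integer and A > 0. The function g^IM is monotone nondecreasing on [0,1]: for all ω₁, ω₂ ∈ [0,1] with ω₁ ≤ ω₂ one has g^IM(ω₁) ≤ g^IM(ω₂). -/
/-- The WENO-IM(k, A) mapping function. -/
noncomputable def gIM (d A : ℝ) (k : ℕ) (ω : ℝ) : ℝ :=
  d + A * (ω - d) ^ (k + 1) / (A * (ω - d) ^ k + ω * (1 - ω))

/-- The denominator of the mapping function is positive on `[0, 1]`. -/
theorem gIM_denom_pos {d A ω : ℝ} {k : ℕ} (hd : d ∈ Set.Ioo (0 : ℝ) 1) (hke : Even k)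
    (hA : 0 < A) (hω : ω ∈ Set.Icc (0 : ℝ) 1) :
    0 < A * (ω - d) ^ k + ω * (1 - ω) := by
  obtain ⟨hd0, hd1⟩ := hd
  obtain ⟨h0, h1⟩ := hω
  rcases eq_or_ne ω d with rfl | hne
  · have hp : 0 < ω * (1 - ω) := mul_pos hd0 (by linarith)
    have hq : 0 ≤ A * (ω - ω) ^ k := mul_nonneg hA.le (hke.pow_nonneg _)
    linarith
  · have hp : 0 < A * (ω - d) ^ k := mul_pos hA (hke.pow_pos (sub_ne_zero.mpr hne))
    have hq : 0 ≤ ω * (1 - ω) := mul_nonneg h0 (by linarith)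
    linarith

/-- For even `k`, the function `(ω - d) ^ (k + 1) / (ω * (1 - ω))` is nondecreasing,
in cross-multiplied form. -/
theorem sub_pow_succ_mul_le {d x y : ℝ} {k : ℕ} (hd : d ∈ Set.Ioo (0 : ℝ) 1) (hke : Even k)
    (hx : 0 ≤ x) (hxy : x ≤ y) (hy : y ≤ 1) :
    (x - d) ^ (k + 1) * (y * (1 - y)) ≤ (y - d) ^ (k + 1) * (x * (1 - x)) := by
  obtain ⟨hd0, hd1⟩ := hd
  have hx1 : 0 ≤ 1 - x := by linarith
  have hy1 : 0 ≤ 1 - y := by linarith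
  have hy0 : 0 ≤ y := hx.trans hxy
  have hxk : 0 ≤ (x - d) ^ k := hke.pow_nonneg _
  have hyk : 0 ≤ (y - d) ^ k := hke.pow_nonneg _
  rcases le_total d x with hdx | hdx
  · have hlin : (x - d) * y ≤ (y - d) * x := by nlinarith
    have hpow : (x - d) ^ k * (1 - y) ≤ (y - d) ^ k * (1 - x) :=
      mul_le_mul (pow_le_pow_left₀ (by linarith) (by linarith) k) (by linarith) hy1 hyk
    calc (x - d) ^ (k + 1) * (y * (1 - y))
        = ((x - d) * y) * ((x - d) ^ k * (1 - y)) := by ring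
      _ ≤ ((y - d) * x) * ((y - d) ^ k * (1 - x)) :=
        mul_le_mul hlin hpow (mul_nonneg hxk hy1) (mul_nonneg (by linarith) hx)
      _ = _ := by ring
  · rcases le_total d y with hdy | hdy
    · have hl : (x - d) ^ (k + 1) * (y * (1 - y)) ≤ 0 := by
        rw [pow_succ]
        exact mul_nonpos_of_nonpos_of_nonneg
          (mul_nonpos_of_nonneg_of_nonpos hxk (by linarith)) (mul_nonneg hy0 hy1)
      have hr : 0 ≤ (y - d) ^ (k + 1) * (x * (1 - x)) :=
        mul_nonneg (pow_nonneg (by linarith) _) (mul_nonneg hx hx1)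
      exact hl.trans hr
    · have hlin : (d - y) * (1 - x) ≤ (d - x) * (1 - y) := by nlinarith
      have hpow : (y - d) ^ k * x ≤ (x - d) ^ k * y := by
        rw [← hke.neg_pow (y - d), ← hke.neg_pow (x - d)]
        exact mul_le_mul (pow_le_pow_left₀ (by linarith) (by linarith) k) hxy hx
          (hke.pow_nonneg _)
      have hmul : ((d - y) * (1 - x)) * ((y - d) ^ k * x)
          ≤ ((d - x) * (1 - y)) * ((x - d) ^ k * y) :=
        mul_le_mul hlin hpow (mul_nonneg hyk hx) (mul_nonneg (by linarith) hy1)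
      rw [pow_succ, pow_succ]
      linarith

theorem stmt_6 (d : ℝ) (hd : d ∈ Set.Ioo (0 : ℝ) 1)
    (k : ℕ) (hk : 0 < k) (hke : Even k) (A : ℝ) (hA : 0 < A) :
    ∀ ω₁ ∈ Set.Icc (0 : ℝ) 1, ∀ ω₂ ∈ Set.Icc (0 : ℝ) 1,
      ω₁ ≤ ω₂ → gIM d A k ω₁ ≤ gIM d A k ω₂ := by
  intro x hx y hy hxy
  unfold gIM
  apply (add_le_add_iff_left d).mpr
  rw [div_le_div_iff₀ (gIM_denom_pos hd hke hA hx) (gIM_denom_pos hd hke hA hy)]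
  have hmain := mul_le_mul_of_nonneg_left
    (sub_pow_succ_mul_le hd hke hx.1 hxy hy.2) hA.le
  have hcross : 0 ≤ A ^ 2 * ((x - d) ^ k * (y - d) ^ k) * (y - x) :=
    mul_nonneg (mul_nonneg (sq_nonneg A) (mul_nonneg (hke.pow_nonneg _) (hke.pow_nonneg _)))
      (sub_nonneg.mpr hxy)
  rw [pow_succ, pow_succ] at hmain ⊢
  linarith
end

section
/- Let d ∈ (0,1), let k be a positive even integer and A > 0. The function g^IM, given by the same rational formula on an open neighborhood of d (where the denominator A(ω − d)^k + ω(1 − ω) is positive), satisfies that its j-th derivative at ω = d vanishes for every j with 1 ≤ j ≤ k, while its (k+1)-th derivative at ω = d is nonzero. -/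
/-- The iterated derivatives of `c + (x - z) ^ n * u x` at `z`, for `u` analytic and nonzero at `z`,
vanish in the orders `1, …, n - 1` and do not vanish in the order `n`. -/
theorem iteratedDeriv_const_add_pow_mul {u : ℝ → ℝ} {z : ℝ} (c : ℝ) {n : ℕ} (hn : 0 < n)
    (hu : AnalyticAt ℝ u z) (huz : u z ≠ 0) :
    (∀ j : ℕ, 1 ≤ j → j < n → iteratedDeriv j (fun x ↦ c + (x - z) ^ n * u x) z = 0) ∧
    iteratedDeriv n (fun x ↦ c + (x - z) ^ n * u x) z ≠ 0 := by
  have hf : AnalyticAt ℝ (fun x ↦ (x - z) ^ n * u x) z := by fun_prop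
  have hord : analyticOrderAt (fun x ↦ (x - z) ^ n * u x) z = n :=
    hf.analyticOrderAt_eq_natCast.2 ⟨u, hu, huz, by simp⟩
  obtain ⟨hlow, htop⟩ := (analyticOrderAt_eq_nat_iff_iteratedDeriv_eq_zero hf).1 hord
  refine ⟨fun j hj hjn ↦ ?_, ?_⟩
  · rw [iteratedDeriv_const_add hj]
    exact hlow j hjn
  · rwa [iteratedDeriv_const_add hn]

theorem stmt_7 (d : ℝ) (hd : d ∈ Set.Ioo (0 : ℝ) 1)
    (k : ℕ) (hk : 0 < k) (hke : Even k) (A : ℝ) (hA : 0 < A) :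
    (∀ᶠ ω in nhds d, 0 < A * (ω - d) ^ k + ω * (1 - ω)) ∧
    (∀ j : ℕ, 1 ≤ j → j ≤ k → iteratedDeriv j (gIM d A k) d = 0) ∧
    iteratedDeriv (k + 1) (gIM d A k) d ≠ 0 := by
  have hpos : 0 < A * (d - d) ^ k + d * (1 - d) := by
    simpa [hk.ne'] using mul_pos hd.1 (sub_pos.2 hd.2)
  have hcont : Continuous fun ω : ℝ ↦ A * (ω - d) ^ k + ω * (1 - ω) := by fun_prop
  have hu : AnalyticAt ℝ (fun ω : ℝ ↦ A / (A * (ω - d) ^ k + ω * (1 - ω))) d :=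
    AnalyticAt.div (by fun_prop) (by fun_prop) hpos.ne'
  have hg : gIM d A k =
      fun ω ↦ d + (ω - d) ^ (k + 1) * (A / (A * (ω - d) ^ k + ω * (1 - ω))) := by
    funext ω
    rw [gIM]
    ring
  obtain ⟨hlow, htop⟩ :=
    iteratedDeriv_const_add_pow_mul d k.succ_pos hu (div_pos hA hpos).ne'
  rw [hg]
  exact ⟨hcont.continuousAt.eventually (lt_mem_nhds hpos),
    fun j hj hjk ↦ hlow j hj (Nat.lt_succ_of_le hjk), htop⟩
end

section
/- Let d ∈ (0,1), m > 0, and let k be a positive integer. Define P(ω) = T(ω)·(k + 1 − q_d(ω)/m) for ω ∈ (0,1). Then P(ω) → 0 as ω → 0⁺ and P(ω) → 0 as ω → 1⁻. -/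
/-- The function `q_d`. -/
noncomputable def qd (d ω : ℝ) : ℝ :=
  (ω - d) * (d / ω ^ 2 * (1 - Real.log ω) +
    (1 - d) / (1 - ω) ^ 2 * (Real.log (1 - ω) - 1))

/-- The function `T(ω) = ω^(d/(mω)) (1-ω)^((1-d)/(m(1-ω)))`, using real powers. -/
noncomputable def Tfun (d m ω : ℝ) : ℝ :=
  ω ^ (d / (m * ω)) * (1 - ω) ^ ((1 - d) / (m * (1 - ω)))

open Filter Topology in
/-- `ω ^ (c / ω)` vanishes faster than `ω ^ 3` at `0⁺`. -/
theorem tendsto_rpow_div_self_div_cube {c : ℝ} (hc : 0 < c) :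
    Tendsto (fun ω : ℝ => ω ^ (c / ω) / ω ^ 3) (𝓝[>] 0) (𝓝 0) := by
  have hid : Tendsto (fun ω : ℝ => ω) (𝓝[>] 0) (𝓝 0) :=
    tendsto_nhdsWithin_of_tendsto_nhds tendsto_id
  have hlt : Set.Ioo (0 : ℝ) (min 1 (c / 4)) ∈ 𝓝[>] (0 : ℝ) :=
    Ioo_mem_nhdsGT (by positivity)
  refine tendsto_of_tendsto_of_tendsto_of_le_of_le' tendsto_const_nhds hid ?_ ?_
  · filter_upwards [hlt] with ω hω
    have := hω.1
    positivity
  · filter_upwards [hlt] with ω ⟨h0, h1⟩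
    obtain ⟨h1, h2⟩ := lt_min_iff.mp h1
    have hexp : (4 : ℝ) ≤ c / ω := by
      rw [le_div_iff₀ h0]
      linarith
    have hle : ω ^ (c / ω) ≤ ω ^ (4 : ℝ) :=
      Real.rpow_le_rpow_of_exponent_ge h0 h1.le hexp
    rw [div_le_iff₀ (by positivity)]
    calc ω ^ (c / ω) ≤ ω ^ (4 : ℝ) := hle
      _ = ω * ω ^ 3 := by norm_cast; ring

open Filter Topology in
theorem tendsto_Tfun_mul_sub_qd_zero {d m : ℝ} (hd : 0 < d) (hm : 0 < m) (K : ℝ) :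
    Tendsto (fun ω => Tfun d m ω * (K - qd d ω / m)) (𝓝[>] 0) (𝓝 0) := by
  have hpow : Tendsto (fun ω : ℝ => (1 - ω) ^ ((1 - d) / (m * (1 - ω)))) (𝓝[>] 0) (𝓝 1) := by
    have hcont : ContinuousAt (fun ω : ℝ => (1 - ω) ^ ((1 - d) / (m * (1 - ω)))) 0 := by
      refine ContinuousAt.rpow (by fun_prop) ?_ (by norm_num)
      exact ContinuousAt.div (by fun_prop) (by fun_prop) (by simpa using hm.ne')
    simpa using hcont.tendsto.mono_left nhdsWithin_le_nhds
  have hfac : Tendsto (fun ω : ℝ => K * ω ^ 3 - (ω - d) * (d * (ω - ω * Real.log ω) +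
      ω ^ 3 * ((1 - d) / (1 - ω) ^ 2 * (Real.log (1 - ω) - 1))) / m) (𝓝[>] 0) (𝓝 0) := by
    have hlog : ContinuousAt (fun ω : ℝ => ω * Real.log ω) 0 :=
      Real.continuous_mul_log.continuousAt
    have hlog' : ContinuousAt (fun ω : ℝ => Real.log (1 - ω)) 0 :=
      ContinuousAt.log (by fun_prop) (by norm_num)
    have hdiv : ContinuousAt (fun ω : ℝ => (1 - d) / (1 - ω) ^ 2) 0 :=
      ContinuousAt.div (by fun_prop) (by fun_prop) (by norm_num)
    have hcont : ContinuousAt (fun ω : ℝ => K * ω ^ 3 - (ω - d) * (d * (ω - ω * Real.log ω) +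
        ω ^ 3 * ((1 - d) / (1 - ω) ^ 2 * (Real.log (1 - ω) - 1))) / m) 0 := by
      fun_prop
    simpa using hcont.tendsto.mono_left nhdsWithin_le_nhds
  have hprod := (hpow.mul (tendsto_rpow_div_self_div_cube (div_pos hd hm))).mul hfac
  simp only [mul_zero] at hprod
  refine hprod.congr' ?_
  filter_upwards [self_mem_nhdsWithin] with ω hω
  have hω0 : ω ≠ 0 := ne_of_gt hω
  have hscale : K - qd d ω / m = (K * ω ^ 3 - (ω - d) * (d * (ω - ω * Real.log ω) +
      ω ^ 3 * ((1 - d) / (1 - ω) ^ 2 * (Real.log (1 - ω) - 1))) / m) / ω ^ 3 := by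
    unfold qd
    generalize (1 - d) / (1 - ω) ^ 2 * (Real.log (1 - ω) - 1) = r
    field_simp
  rw [hscale, Tfun, div_div]
  ring

theorem Tfun_one_sub (d m ω : ℝ) : Tfun d m (1 - ω) = Tfun (1 - d) m ω := by
  simp only [Tfun, sub_sub_cancel]
  ring

theorem qd_one_sub (d ω : ℝ) : qd d (1 - ω) = qd (1 - d) ω := by
  simp only [qd, sub_sub_cancel]
  ring

theorem stmt_16 (d : ℝ) (hd : d ∈ Set.Ioo (0 : ℝ) 1) (m : ℝ) (hm : 0 < m)
    (k : ℕ) (hk : 0 < k) :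
    Filter.Tendsto (fun ω => Tfun d m ω * ((k : ℝ) + 1 - qd d ω / m))
      (nhdsWithin 0 (Set.Ioi 0)) (nhds 0) ∧
    Filter.Tendsto (fun ω => Tfun d m ω * ((k : ℝ) + 1 - qd d ω / m))
      (nhdsWithin 1 (Set.Iio 1)) (nhds 0) := by
  refine ⟨tendsto_Tfun_mul_sub_qd_zero hd.1 hm _, ?_⟩
  have hreflect : Filter.Tendsto (fun ω : ℝ => 1 - ω)
      (nhdsWithin 1 (Set.Iio 1)) (nhdsWithin 0 (Set.Ioi 0)) := by
    refine tendsto_nhdsWithin_iff.mpr ⟨?_, ?_⟩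
    · have hcont : ContinuousAt (fun ω : ℝ => 1 - ω) 1 := by fun_prop
      simpa using hcont.tendsto.mono_left nhdsWithin_le_nhds
    · filter_upwards [self_mem_nhdsWithin] with ω hω
      exact sub_pos.mpr (Set.mem_Iio.mp hω)
  have hlim := (tendsto_Tfun_mul_sub_qd_zero (sub_pos.mpr hd.2) hm ((k : ℝ) + 1)).comp hreflect
  simpa only [Function.comp_def, ← Tfun_one_sub, ← qd_one_sub, sub_sub_cancel] using hlim
end

section
/- Let d ∈ (0,1), let k be a positive even integer, A > 0, and let α ∈ ℝ satisfy α > 0 and α > q_d(ω) for all ω ∈ (0,1). Then for every m with m ≥ α/(k + 1): (i) g is monotone nondecreasing on (0,1), i.e. ω₁ ≤ ω₂ implies g(ω₁) ≤ g(ω₂) for ω₁, ω₂ ∈ (0,1); and (ii) g is differentiable on (0,1) with g'(ω) → 1 as ω → 0⁺ and g'(ω) → 1 as ω → 1⁻. -/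
/-- The WENO-MAIM1 mapping function (with the parameter `ε_A` dropped). -/
noncomputable def gMAIM1 (d A m : ℝ) (k : ℕ) (ω : ℝ) : ℝ :=
  d + A * (ω - d) ^ (k + 1) / (A * (ω - d) ^ k + Tfun d m ω)

open Filter Topology Set

lemma Tfun_eq_exp {d m ω : ℝ} (hω : ω ∈ Ioo (0 : ℝ) 1) :
    Tfun d m ω = Real.exp (d / m * (Real.log ω / ω)) *
      Real.exp ((1 - d) / m * (Real.log (1 - ω) / (1 - ω))) := by
  have h1 : 0 < 1 - ω := by linarith [hω.2]
  rw [Tfun, Real.rpow_def_of_pos hω.1, Real.rpow_def_of_pos h1]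
  congr 2 <;> (simp only [div_eq_mul_inv, mul_inv]; ring)

lemma Tfun_pos {d m ω : ℝ} (hω : ω ∈ Ioo (0 : ℝ) 1) : 0 < Tfun d m ω := by
  rw [Tfun_eq_exp hω]; positivity

lemma hasDerivAt_Tfun {d m ω : ℝ} (hω : ω ∈ Ioo (0 : ℝ) 1) :
    HasDerivAt (Tfun d m) (Tfun d m ω * ((d / ω ^ 2 * (1 - Real.log ω) +
      (1 - d) / (1 - ω) ^ 2 * (Real.log (1 - ω) - 1)) / m)) ω := by
  have h0 : ω ≠ 0 := hω.1.ne'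
  have h1 : 1 - ω ≠ 0 := by linarith [hω.2]
  have hs : HasDerivAt (fun x : ℝ => 1 - x) (-1) ω := (hasDerivAt_id ω).const_sub 1
  have key := (((Real.hasDerivAt_log h0).div (hasDerivAt_id ω) h0).const_mul (d / m)).exp.mul
    (((hs.log h1).div hs h1).const_mul ((1 - d) / m)).exp
  refine (key.congr_of_eventuallyEq (f₁ := Tfun d m) ?_).congr_deriv ?_
  · filter_upwards [isOpen_Ioo.mem_nhds hω] with x hx using Tfun_eq_exp hx
  rw [Tfun_eq_exp hω]
  simp only [id, Pi.div_apply]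
  field_simp
  ring

lemma gMAIM1_denom_pos {d A m ω : ℝ} {k : ℕ} (hke : Even k) (hA : 0 < A)
    (hω : ω ∈ Ioo (0 : ℝ) 1) : 0 < A * (ω - d) ^ k + Tfun d m ω := by
  have := hke.pow_nonneg (ω - d)
  have := Tfun_pos (d := d) (m := m) hω
  positivity

lemma hasDerivAt_gMAIM1 {d A m ω : ℝ} {k : ℕ} (hk : 0 < k) (hke : Even k) (hA : 0 < A)
    (hω : ω ∈ Ioo (0 : ℝ) 1) :
    HasDerivAt (gMAIM1 d A m k)
      (A * (ω - d) ^ k * (A * (ω - d) ^ k + ((k + 1) * Tfun d m ω - Tfun d m ω * qd d ω / m)) /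
        (A * (ω - d) ^ k + Tfun d m ω) ^ 2) ω := by
  have hD := (gMAIM1_denom_pos (d := d) (m := m) hke hA hω).ne'
  have hu : HasDerivAt (fun x : ℝ => x - d) 1 ω := (hasDerivAt_id ω).sub_const d
  have key := (((hu.pow (k + 1)).const_mul A).div
    (((hu.pow k).const_mul A).add (hasDerivAt_Tfun (d := d) (m := m) hω)) hD).const_add d
  refine HasDerivAt.congr_deriv (f := gMAIM1 d A m k) key ?_
  obtain ⟨j, rfl⟩ : ∃ j, k = j + 1 := ⟨k - 1, by omega⟩
  simp only [Pi.add_apply, Pi.pow_apply, qd]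
  congr 1
  push_cast
  ring

lemma tendsto_log_div_exp_bound {c : ℝ} (hc : 0 < c) :
    Tendsto (fun ω : ℝ => Real.exp (c * (Real.log ω / ω)) * (1 / ω ^ 2 * (1 - Real.log ω)))
      (𝓝[>] 0) (𝓝 0) := by
  have hpow : Tendsto (fun x : ℝ => x ^ 3 * Real.exp (-c * x)) atTop (𝓝 0) := by
    simpa using tendsto_rpow_mul_exp_neg_mul_atTop_nhds_zero 3 c hc
  have hub := hpow.comp tendsto_inv_nhdsGT_zero
  have hev : ∀ᶠ ω : ℝ in 𝓝[>] 0, ω ∈ Ioo (0 : ℝ) (Real.exp (-1)) :=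
    Ioo_mem_nhdsGT (Real.exp_pos _)
  refine tendsto_of_tendsto_of_tendsto_of_le_of_le' tendsto_const_nhds hub ?_ ?_
  · filter_upwards [hev] with ω hω
    have : Real.log ω < -1 := (Real.log_lt_iff_lt_exp hω.1).2 hω.2
    have : 0 ≤ 1 - Real.log ω := by linarith
    positivity
  · filter_upwards [hev] with ω hω
    have hl : Real.log ω < -1 := (Real.log_lt_iff_lt_exp hω.1).2 hω.2
    have hpos := hω.1
    have hi : 1 - Real.log ω ≤ ω⁻¹ := by
      have := Real.log_le_sub_one_of_pos (inv_pos.2 hpos)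
      rw [Real.log_inv] at this
      linarith
    have he : Real.exp (c * (Real.log ω / ω)) ≤ Real.exp (-c * ω⁻¹) := by
      apply Real.exp_le_exp.2
      rw [div_eq_mul_inv]
      have : 0 < c * ω⁻¹ := by positivity
      nlinarith
    have h2 : 1 / ω ^ 2 * (1 - Real.log ω) ≤ (ω⁻¹) ^ 3 := by
      calc 1 / ω ^ 2 * (1 - Real.log ω) ≤ 1 / ω ^ 2 * ω⁻¹ := by gcongr
        _ = (ω⁻¹) ^ 3 := by field_simp
    have h3 : 0 ≤ 1 / ω ^ 2 * (1 - Real.log ω) :=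
      mul_nonneg (by positivity) (by linarith)
    calc _ ≤ Real.exp (-c * ω⁻¹) * (ω⁻¹) ^ 3 := mul_le_mul he h2 h3 (Real.exp_pos _).le
      _ = _ := mul_comm _ _

lemma tendsto_exp_log_div {c : ℝ} (hc : 0 < c) :
    Tendsto (fun ω : ℝ => Real.exp (c * (Real.log ω / ω))) (𝓝[>] 0) (𝓝 0) := by
  refine tendsto_of_tendsto_of_tendsto_of_le_of_le' tendsto_const_nhds
    (tendsto_log_div_exp_bound hc) (Eventually.of_forall fun _ => (Real.exp_pos _).le) ?_
  filter_upwards [Ioo_mem_nhdsGT (zero_lt_one' ℝ)] with ω hω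
  have h1 : 1 ≤ 1 / ω ^ 2 := by
    rw [le_div_iff₀ (pow_pos hω.1 2)]
    nlinarith [hω.1, hω.2]
  have h2 : 1 ≤ 1 - Real.log ω := by linarith [Real.log_neg hω.1 hω.2]
  exact le_mul_of_one_le_right (Real.exp_pos _).le (one_le_mul_of_one_le_of_one_le h1 h2)

lemma tendsto_deriv_gMAIM1_zero {d A m : ℝ} {k : ℕ} (hd : d ∈ Ioo (0 : ℝ) 1) (hk : 0 < k)
    (hke : Even k) (hA : 0 < A) (hm : 0 < m) :
    Tendsto (deriv (gMAIM1 d A m k)) (𝓝[>] 0) (𝓝 1) := by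
  have hc : 0 < d / m := div_pos hd.1 hm
  have hev : ∀ᶠ ω : ℝ in 𝓝[>] 0, ω ∈ Ioo (0 : ℝ) 1 := Ioo_mem_nhdsGT zero_lt_one
  have hP := tendsto_exp_log_div hc
  have hQ := tendsto_log_div_exp_bound hc
  have hR : Tendsto (fun ω : ℝ => Real.exp ((1 - d) / m * (Real.log (1 - ω) / (1 - ω))))
      (𝓝[>] 0) (𝓝 1) := by
    have : ContinuousAt
        (fun ω : ℝ => Real.exp ((1 - d) / m * (Real.log (1 - ω) / (1 - ω)))) 0 := by
      fun_prop (disch := norm_num)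
    simpa using this.tendsto.mono_left nhdsWithin_le_nhds
  have hS : Tendsto (fun ω : ℝ => (1 - d) / (1 - ω) ^ 2 * (Real.log (1 - ω) - 1))
      (𝓝[>] 0) (𝓝 (-(1 - d))) := by
    have : ContinuousAt
        (fun ω : ℝ => (1 - d) / (1 - ω) ^ 2 * (Real.log (1 - ω) - 1)) 0 := by
      fun_prop (disch := norm_num)
    simpa using this.tendsto.mono_left nhdsWithin_le_nhds
  have hU : Tendsto (fun ω : ℝ => ω - d) (𝓝[>] 0) (𝓝 (-d)) := by
    have : ContinuousAt (fun ω : ℝ => ω - d) 0 := by fun_prop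
    simpa using this.tendsto.mono_left nhdsWithin_le_nhds
  have hT : Tendsto (Tfun d m) (𝓝[>] 0) (𝓝 0) := by
    have h := hP.mul hR
    rw [zero_mul] at h
    refine h.congr' ?_
    filter_upwards [hev] with ω hω using (Tfun_eq_exp hω).symm
  have hTq : Tendsto (fun ω => Tfun d m ω * qd d ω) (𝓝[>] 0) (𝓝 0) := by
    have h := (hR.mul hU).mul ((hQ.const_mul d).add (hP.mul hS))
    rw [mul_zero, zero_mul, add_zero, mul_zero] at h
    refine h.congr' ?_
    filter_upwards [hev] with ω hω
    rw [Tfun_eq_exp hω, qd]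
    ring
  have hB : Tendsto (fun ω : ℝ => A * (ω - d) ^ k) (𝓝[>] 0) (𝓝 (A * (-d) ^ k)) :=
    (hU.pow k).const_mul A
  have hB0 : A * (-d) ^ k ≠ 0 := mul_ne_zero hA.ne' (pow_ne_zero _ (neg_ne_zero.2 hd.1.ne'))
  have h := (hB.mul (hB.add ((hT.const_mul ((k : ℝ) + 1)).sub (hTq.div_const m)))).div
    ((hB.add hT).pow 2) (by simpa using hB0)
  have hval : A * (-d) ^ k * (A * (-d) ^ k + (((k : ℝ) + 1) * 0 - 0 / m)) /
      (A * (-d) ^ k + 0) ^ 2 = 1 := by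
    rw [mul_zero, zero_div, sub_zero, add_zero, ← sq]
    exact div_self (pow_ne_zero 2 hB0)
  rw [hval] at h
  refine h.congr' ?_
  filter_upwards [hev] with ω hω using (hasDerivAt_gMAIM1 hk hke hA hω).deriv.symm

lemma gMAIM1_reflect {d A m : ℝ} {k : ℕ} (hke : Even k) (ω : ℝ) :
    gMAIM1 d A m k ω = 1 - gMAIM1 (1 - d) A m k (1 - ω) := by
  have hu : 1 - ω - (1 - d) = -(ω - d) := by ring
  have hT : Tfun (1 - d) m (1 - ω) = Tfun d m ω := by
    simp only [Tfun, sub_sub_cancel]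
    ring
  rw [gMAIM1, gMAIM1, hu, hT, hke.neg_pow, hke.add_one.neg_pow]
  ring

lemma tendsto_deriv_gMAIM1_one {d A m : ℝ} {k : ℕ} (hd : d ∈ Ioo (0 : ℝ) 1) (hk : 0 < k)
    (hke : Even k) (hA : 0 < A) (hm : 0 < m) :
    Tendsto (deriv (gMAIM1 d A m k)) (𝓝[<] 1) (𝓝 1) := by
  have hd' : 1 - d ∈ Ioo (0 : ℝ) 1 := ⟨by linarith [hd.2], by linarith [hd.1]⟩
  have hderiv : deriv (gMAIM1 d A m k) =
      fun ω => deriv (gMAIM1 (1 - d) A m k) (1 - ω) := by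
    ext ω
    rw [show gMAIM1 d A m k = fun x => 1 - gMAIM1 (1 - d) A m k (1 - x) from
      funext (gMAIM1_reflect hke), deriv_const_sub, deriv_comp_const_sub, neg_neg]
  rw [hderiv]
  refine (tendsto_deriv_gMAIM1_zero hd' hk hke hA hm).comp (tendsto_nhdsWithin_iff.2 ⟨?_, ?_⟩)
  · have : ContinuousAt (fun ω : ℝ => 1 - ω) 1 := by fun_prop
    simpa using this.tendsto.mono_left nhdsWithin_le_nhds
  · filter_upwards [self_mem_nhdsWithin] with ω hω
    exact mem_Ioi.2 (sub_pos.2 (mem_Iio.1 hω))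

theorem stmt_18 (d : ℝ) (hd : d ∈ Set.Ioo (0 : ℝ) 1)
    (k : ℕ) (hk : 0 < k) (hke : Even k) (A : ℝ) (hA : 0 < A)
    (α : ℝ) (hα : 0 < α) (hαq : ∀ ω ∈ Set.Ioo (0 : ℝ) 1, qd d ω < α) :
    ∀ m : ℝ, α / (k + 1) ≤ m →
      (∀ ω₁ ∈ Set.Ioo (0 : ℝ) 1, ∀ ω₂ ∈ Set.Ioo (0 : ℝ) 1,
        ω₁ ≤ ω₂ → gMAIM1 d A m k ω₁ ≤ gMAIM1 d A m k ω₂) ∧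
      (∀ ω ∈ Set.Ioo (0 : ℝ) 1, DifferentiableAt ℝ (gMAIM1 d A m k) ω) ∧
      Filter.Tendsto (deriv (gMAIM1 d A m k)) (nhdsWithin 0 (Set.Ioi 0)) (nhds 1) ∧
      Filter.Tendsto (deriv (gMAIM1 d A m k)) (nhdsWithin 1 (Set.Iio 1)) (nhds 1) := by
  intro m hm
  have hk1 : (0 : ℝ) < k + 1 := by positivity
  have hm0 : 0 < m := (div_pos hα hk1).trans_le hm
  refine ⟨?_, fun ω hω => (hasDerivAt_gMAIM1 hk hke hA hω).differentiableAt,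
    tendsto_deriv_gMAIM1_zero hd hk hke hA hm0, tendsto_deriv_gMAIM1_one hd hk hke hA hm0⟩
  have hmono : MonotoneOn (gMAIM1 d A m k) (Ioo 0 1) := by
    refine monotoneOn_of_deriv_nonneg (convex_Ioo 0 1)
      (fun ω hω => (hasDerivAt_gMAIM1 hk hke hA hω).continuousAt.continuousWithinAt) ?_ ?_
    all_goals rw [interior_Ioo]
    · exact fun ω hω =>
        (hasDerivAt_gMAIM1 hk hke hA hω).differentiableAt.differentiableWithinAt
    · intro ω hω
      rw [(hasDerivAt_gMAIM1 hk hke hA hω).deriv]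
      have hq : qd d ω / m ≤ k + 1 := by
        rw [div_le_iff₀ hm0]
        rw [div_le_iff₀ hk1] at hm
        linarith [hαq ω hω]
      have hT := mul_nonneg (Tfun_pos (d := d) (m := m) hω).le (sub_nonneg.2 hq)
      have hB : 0 ≤ A * (ω - d) ^ k := mul_nonneg hA.le (hke.pow_nonneg _)
      have hE : 0 ≤ (k + 1) * Tfun d m ω - Tfun d m ω * qd d ω / m := by
        rw [mul_div_assoc]
        linarith
      positivity
  exact fun ω₁ h₁ ω₂ h₂ h => hmono h₁ h₂ h
end

section
/- Let r and n_cp be integers with 1 ≤ n_cp ≤ r − 2 (so r ≥ 3), and set c = r − 1 − n_cp. Define K = ⌈r/c − 2⌉ + (1 + (−1)^{⌈r/c − 2⌉})/2 and K' = ⌈r/c − 1⌉ + (1 − (−1)^{⌈r/c − 1⌉})/2. Then K is the least positive odd integer k satisfying c(k + 2) ≥ r, K' is the least positive even integer k satisfying c(k + 1) ≥ r, and K ≤ K'. -/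
theorem ceil_intCast_div_le_iff {r c : ℤ} (hc : 0 < c) (j : ℤ) :
    ⌈(r : ℚ) / (c : ℚ)⌉ ≤ j ↔ r ≤ c * j := by
  have hc' : (0 : ℚ) < c := by exact_mod_cast hc
  rw [Int.ceil_le, div_le_iff₀ hc', mul_comm (j : ℚ)]
  exact_mod_cast Iff.rfl

theorem stmt_19 (r ncp : ℤ) (h1 : 1 ≤ ncp) (h2 : ncp ≤ r - 2)
    (c : ℤ) (hc : c = r - 1 - ncp)
    (m1 m2 : ℤ)
    (hm1 : m1 = ⌈(r : ℚ) / (c : ℚ) - 2⌉)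
    (hm2 : m2 = ⌈(r : ℚ) / (c : ℚ) - 1⌉)
    (K K' : ℚ)
    (hK : K = (m1 : ℚ) + (1 + (-1 : ℚ) ^ m1) / 2)
    (hK' : K' = (m2 : ℚ) + (1 - (-1 : ℚ) ^ m2) / 2) :
    (∃ k : ℤ, (k : ℚ) = K ∧
      IsLeast {j : ℤ | 0 < j ∧ Odd j ∧ r ≤ c * (j + 2)} k) ∧
    (∃ k : ℤ, (k : ℚ) = K' ∧
      IsLeast {j : ℤ | 0 < j ∧ Even j ∧ r ≤ c * (j + 1)} k) ∧
    K ≤ K' := by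
  have hpos : 0 < c := by omega
  have hM := ceil_intCast_div_le_iff (r := r) hpos
  rw [Int.ceil_sub_ofNat] at hm1
  rw [Int.ceil_sub_one] at hm2
  generalize ⌈(r : ℚ) / (c : ℚ)⌉ = M at hM hm1 hm2
  have hM2 : 2 ≤ M := by
    by_contra! h
    have := (hM 1).1 (by omega)
    omega
  simp only [← hM]
  subst hm1 hm2
  rcases Int.even_or_odd M with hev | hod
  · have e1 : Even (M - 2) := by grind
    have e2 : Odd (M - 1) := by grind
    rw [e1.neg_one_zpow] at hK
    rw [e2.neg_one_zpow] at hK'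
    push_cast at hK hK'
    refine ⟨⟨M - 1, by push_cast; linarith, ⟨by omega, e2, by omega⟩, ?_⟩,
      ⟨M, by linarith, ⟨by omega, hev, by omega⟩, ?_⟩, by linarith⟩
    · rintro j ⟨_, ⟨a, rfl⟩, _⟩
      obtain ⟨b, rfl⟩ := hev
      omega
    · rintro j ⟨_, ⟨a, rfl⟩, _⟩
      obtain ⟨b, rfl⟩ := hev
      omega
  · have e1 : Odd (M - 2) := by grind
    have e2 : Even (M - 1) := by grind
    rw [e1.neg_one_zpow] at hK
    rw [e2.neg_one_zpow] at hK'
    push_cast at hK hK'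
    refine ⟨⟨M - 2, by push_cast; linarith, ⟨by grind, e1, by omega⟩, ?_⟩,
      ⟨M - 1, by push_cast; linarith, ⟨by omega, e2, by omega⟩, ?_⟩, by linarith⟩
    · rintro j ⟨_, _, _⟩
      omega
    · rintro j ⟨_, _, _⟩
      omega
end
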